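/- Let α > −1. (i) There exists a constant C₁ > 0 such that |1−⟨z,w⟩|^{−(n+1+α)} ≤ C₁ / ϱ(z,w)^{n+1+α} for all z, w ∈ 𝔹_n with z ≠ w. (ii) There exist constants C₂, C₃ > 0 such that for all z, w, ζ ∈ 𝔹_n satisfying ϱ(z,ζ) > C₂ ϱ(w,ζ), one has |(1−⟨z,w⟩)^{−(n+1+α)} − (1−⟨z,ζ⟩)^{−(n+1+α)}| ≤ C₃ ϱ(w,ζ)^{1/2} / ϱ(z,ζ)^{n+1+α+1/2}. -/

import Mathlib

open MeasureTheory Filter Topology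
open scoped Classical ENNReal

noncomputable section

/-- `ℂⁿ` with the Euclidean norm. -/
abbrev En (n : ℕ) := EuclideanSpace ℂ (Fin n)

instance (n : ℕ) : MeasurableSpace (En n) := borel _
instance (n : ℕ) : BorelSpace (En n) := ⟨rfl⟩

/-- The Lebesgue volume measure on `ℂⁿ`. -/
def vol (n : ℕ) : Measure (En n) := Measure.addHaar

/-- The open unit ball `𝔹ₙ` of `ℂⁿ`. -/
def uball (n : ℕ) : Set (En n) := Metric.ball 0 1

/-- The Hermitian pairing `⟨z,w⟩ = ∑ⱼ zⱼ * conj wⱼ`. -/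
def herm {n : ℕ} (z w : En n) : ℂ := ∑ j, z j * (starRingEnd ℂ) (w j)

/-- The orthogonal projection `P_z w` onto the line spanned by `z`. -/
def prj {n : ℕ} (z w : En n) : En n :=
  if z = 0 then 0 else (herm w z / herm z z) • z

/-- The Möbius automorphism `φ_z` of the unit ball. -/
def mobius {n : ℕ} (z w : En n) : En n :=
  ((1 : ℂ) / (1 - herm w z)) •
    (z - prj z w - ((Real.sqrt (1 - ‖z‖ ^ 2) : ℝ) : ℂ) • (w - prj z w))

/-- The Bergman metric `β(z,w)`. -/
def bmet {n : ℕ} (z w : En n) : ℝ :=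
  (1 / 2) * Real.log ((1 + ‖mobius z w‖) / (1 - ‖mobius z w‖))

/-- The Bergman metric ball `D(z,γ)`. -/
def Dball {n : ℕ} (z : En n) (γ : ℝ) : Set (En n) :=
  {w | w ∈ uball n ∧ bmet z w < γ}

/-- The normalizing constant `c_α`. -/
def cnorm (n : ℕ) (α : ℝ) : ℝ :=
  if -1 < α then Real.Gamma (n + α + 1) / (n.factorial * Real.Gamma (α + 1)) else 1

/-- The weighted measure `dv_α = c_α (1-|z|²)^α dv` on the unit ball. -/
def measA (n : ℕ) (α : ℝ) : Measure (En n) :=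
  ((vol n).restrict (uball n)).withDensity
    (fun z => ENNReal.ofReal (cnorm n α * (1 - ‖z‖ ^ 2) ^ α))

/-- The invariant measure `dτ = (1-|z|²)^{-(n+1)} dv` on the unit ball. -/
def measTau (n : ℕ) : Measure (En n) :=
  ((vol n).restrict (uball n)).withDensity
    (fun z => ENNReal.ofReal ((1 - ‖z‖ ^ 2) ^ (-((n : ℝ) + 1))))

/-- The Bergman space (quasi-)norm `‖f‖_{p,α}`, valued in `ℝ≥0∞`. -/
def apnorm (n : ℕ) (p α : ℝ) (f : En n → ℂ) : ℝ≥0∞ :=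
  (∫⁻ z, ENNReal.ofReal (‖f z‖ ^ p) ∂measA n α) ^ (1 / p)

/-- The radial derivative `Rf(z) = ∑ z_k ∂f/∂z_k = Df(z)[z]`. -/
def radD {n : ℕ} (f : En n → ℂ) (z : En n) : ℂ := fderiv ℂ f z z

/-- Iterated radial derivative `R^k f`. -/
def radIter {n : ℕ} : ℕ → (En n → ℂ) → En n → ℂ
  | 0, f => f
  | (k + 1), f => radD (radIter k f)

/-- The pseudo-metric `ϱ` on the unit ball. -/
def rho {n : ℕ} (z w : En n) : ℝ :=
  if z ≠ 0 ∧ w ≠ 0 then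
    |‖z‖ - ‖w‖| + ‖1 - herm z w / ((‖z‖ : ℂ) * (‖w‖ : ℂ))‖
  else ‖z‖ + ‖w‖

/-- The weighted Bergman kernel `K_α(z,w) = (1-⟨z,w⟩)^{-(n+1+α)}`. -/
def bergKer {n : ℕ} (α : ℝ) (z w : En n) : ℂ :=
  (1 - herm z w) ^ ((-(((n : ℝ) + 1 + α)) : ℂ))

lemma aux_herm {n : ℕ} (z w : En n) : herm z w = inner ℂ w z := by
  simp [herm, PiLp.inner_apply]

section aux
variable {E : Type*} [NormedAddCommGroup E] [InnerProductSpace ℂ E]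

lemma aux_proj (v x : E) (hv : ‖v‖ = 1) :
    ‖x - (inner ℂ v x : ℂ) • v‖ ^ 2 = ‖x‖ ^ 2 - ‖(inner ℂ v x : ℂ)‖ ^ 2 := by
  have h0 : inner ℂ ((inner ℂ v x : ℂ) • v) (x - (inner ℂ v x : ℂ) • v) = (0 : ℂ) := by
    rw [inner_smul_left, inner_sub_right, inner_smul_right, inner_self_eq_norm_sq_to_K, hv]
    simp
  have h := norm_add_sq_eq_norm_sq_add_norm_sq_of_inner_eq_zero _ _ h0
  rw [add_sub_cancel, norm_smul, hv] at h
  nlinarith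

lemma aux_decomp (u v z : E) (hv : ‖v‖ = 1) :
    (inner ℂ (u - v) z : ℂ) = inner ℂ ((inner ℂ v u - 1 : ℂ) • v) z +
      inner ℂ (u - (inner ℂ v u : ℂ) • v) (z - (inner ℂ v z : ℂ) • v) := by
  have hc : (inner ℂ u v : ℂ) = (starRingEnd ℂ) (inner ℂ v u) := (inner_conj_symm u v).symm
  simp only [inner_sub_left, inner_sub_right, inner_smul_left, inner_smul_right,
    inner_self_eq_norm_sq_to_K, hv, hc, map_sub, map_one]
  simp
  ring

lemma aux_key (u v z : E) (hu : ‖u‖ = 1) (hv : ‖v‖ = 1) (hz : ‖z‖ ≤ 1) :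
    ‖(inner ℂ (u - v) z : ℂ)‖ ≤ ‖1 - (inner ℂ v u : ℂ)‖ +
      2 * √(‖1 - (inner ℂ v u : ℂ)‖ * (1 - ‖(inner ℂ v z : ℂ)‖)) := by
  rw [aux_decomp u v z hv]
  refine (norm_add_le _ _).trans (add_le_add ?_ ?_)
  · refine (norm_inner_le_norm _ _).trans ?_
    rw [norm_smul, hv, norm_sub_rev]
    have := norm_nonneg (1 - (inner ℂ v u : ℂ))
    nlinarith
  · refine (norm_inner_le_norm _ _).trans ?_
    have h1 := aux_proj v u hv
    have h2 := aux_proj v z hv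
    set g := (inner ℂ v u : ℂ)
    set k := (inner ℂ v z : ℂ)
    have hg : ‖g‖ ≤ 1 := by
      refine (norm_inner_le_norm _ _).trans ?_
      rw [hu, hv]; norm_num
    have hk : ‖k‖ ≤ 1 := by
      refine (norm_inner_le_norm _ _).trans ?_
      rw [hv]; linarith
    have h3 : 1 - ‖g‖ ≤ ‖1 - g‖ := by
      have := norm_sub_norm_le (1 : ℂ) g
      simpa using this
    have e1 : ‖u - g • v‖ ^ 2 ≤ 2 * ‖1 - g‖ := by
      rw [h1, hu]; nlinarith [norm_nonneg g]
    have e2 : ‖z - k • v‖ ^ 2 ≤ 2 * (1 - ‖k‖) := by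
      rw [h2]; nlinarith [norm_nonneg k, norm_nonneg z]
    have : (2 : ℝ) * √(‖1 - g‖ * (1 - ‖k‖)) = √((2 * ‖1 - g‖) * (2 * (1 - ‖k‖))) := by
      rw [show (2 * ‖1 - g‖) * (2 * (1 - ‖k‖)) = 2 ^ 2 * (‖1 - g‖ * (1 - ‖k‖)) by ring,
        Real.sqrt_mul (sq_nonneg (2 : ℝ)), Real.sqrt_sq (by norm_num)]
    rw [this]
    apply Real.le_sqrt_of_sq_le
    rw [mul_pow]
    exact mul_le_mul e1 e2 (sq_nonneg _) (by positivity)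

lemma aux_unit (w : E) (hw : w ≠ 0) : ∃ u : E, ‖u‖ = 1 ∧ w = (‖w‖ : ℂ) • u := by
  have h : (‖w‖ : ℂ) ≠ 0 := by simpa using hw
  refine ⟨((‖w‖ : ℂ)⁻¹) • w, ?_, ?_⟩
  · rw [norm_smul]; simp [hw]
  · rw [smul_smul, mul_inv_cancel₀ h, one_smul]

end aux

lemma aux_rho {n : ℕ} (a b : ℝ) (u v : En n) (ha : 0 < a) (hb : 0 < b)
    (hu : ‖u‖ = 1) (hv : ‖v‖ = 1) :
    rho ((a : ℂ) • u) ((b : ℂ) • v) = |a - b| + ‖1 - (inner ℂ v u : ℂ)‖ := by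
  have h1 : (a : ℂ) ≠ 0 := by exact_mod_cast ha.ne'
  have h2 : (b : ℂ) ≠ 0 := by exact_mod_cast hb.ne'
  have hu0 : u ≠ 0 := by intro h; simp [h] at hu
  have hv0 : v ≠ 0 := by intro h; simp [h] at hv
  have e1 : ‖(a : ℂ) • u‖ = a := by rw [norm_smul, hu]; simp [abs_of_pos ha]
  have e2 : ‖(b : ℂ) • v‖ = b := by rw [norm_smul, hv]; simp [abs_of_pos hb]
  rw [rho, if_pos ⟨smul_ne_zero h1 hu0, smul_ne_zero h2 hv0⟩, e1, e2, aux_herm,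
    inner_smul_left, inner_smul_right, Complex.conj_ofReal]
  congr 3
  field_simp

lemma aux_rho_zero {n : ℕ} (z w : En n) (h : z = 0 ∨ w = 0) : rho z w = ‖z‖ + ‖w‖ := by
  rw [rho, if_neg]; tauto

lemma aux_rho_nonneg {n : ℕ} (z w : En n) : 0 ≤ rho z w := by
  rw [rho]; split_ifs <;> positivity

lemma aux_rho_le {n : ℕ} (z w : En n) (hz : z ∈ uball n) (hw : w ∈ uball n) :
    rho z w ≤ 3 * ‖1 - herm z w‖ := by
  have hz1 : ‖z‖ < 1 := by simpa [uball] using hz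
  have hw1 : ‖w‖ < 1 := by simpa [uball] using hw
  by_cases hz0 : z = 0
  · subst hz0
    rw [aux_rho_zero _ _ (Or.inl rfl), aux_herm]; simp; linarith
  by_cases hw0 : w = 0
  · subst hw0
    rw [aux_rho_zero _ _ (Or.inr rfl), aux_herm]; simp; linarith
  obtain ⟨u, hu, hzu⟩ := aux_unit z hz0
  obtain ⟨v, hv, hwv⟩ := aux_unit w hw0
  have ha : 0 < ‖z‖ := norm_pos_iff.2 hz0
  have hb : 0 < ‖w‖ := norm_pos_iff.2 hw0
  generalize ‖z‖ = a at *
  generalize ‖w‖ = b at *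
  subst hzu hwv
  rw [aux_rho a b u v ha hb hu hv, aux_herm, inner_smul_left, inner_smul_right,
    Complex.conj_ofReal]
  set g := (inner ℂ v u : ℂ)
  have hg : ‖g‖ ≤ 1 := by
    refine (norm_inner_le_norm _ _).trans ?_
    rw [hu, hv]; norm_num
  have hn : ‖(b : ℂ) * (a * g)‖ = b * a * ‖g‖ := by
    simp [abs_of_pos ha, abs_of_pos hb]; ring
  have h1 : 1 - a * b ≤ ‖1 - (b : ℂ) * (a * g)‖ := by
    have := norm_sub_norm_le (1 : ℂ) ((b : ℂ) * (a * g))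
    rw [hn, norm_one] at this
    have := mul_le_of_le_one_right (mul_pos hb ha).le hg
    linarith
  have h2 : |a - b| ≤ 1 - a * b := by
    rw [abs_le]; constructor <;> nlinarith
  have h3 : ‖1 - g‖ ≤ ‖1 - (b : ℂ) * (a * g)‖ + (1 - a * b) := by
    have e : 1 - g = (1 - (b : ℂ) * (a * g)) - ((1 - a * b : ℝ) : ℂ) * g := by
      push_cast; ring
    have hab : 0 ≤ 1 - a * b := by nlinarith
    rw [e]
    refine (norm_sub_le _ _).trans ?_
    gcongr
    rw [norm_mul, Complex.norm_real, Real.norm_of_nonneg hab]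
    exact mul_le_of_le_one_right hab hg
  linarith

lemma aux_rho_pos {n : ℕ} (z w : En n) (h : z ≠ w) : 0 < rho z w := by
  by_cases hz0 : z = 0
  · subst hz0
    rw [aux_rho_zero _ _ (Or.inl rfl)]; simpa using h.symm
  by_cases hw0 : w = 0
  · subst hw0
    rw [aux_rho_zero _ _ (Or.inr rfl)]; simpa using h
  obtain ⟨u, hu, hzu⟩ := aux_unit z hz0
  obtain ⟨v, hv, hwv⟩ := aux_unit w hw0
  have ha : 0 < ‖z‖ := norm_pos_iff.2 hz0
  have hb : 0 < ‖w‖ := norm_pos_iff.2 hw0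
  generalize ‖z‖ = a at *
  generalize ‖w‖ = b at *
  subst hzu hwv
  rw [aux_rho a b u v ha hb hu hv]
  by_contra hc
  have p1 := abs_nonneg (a - b)
  have p2 := norm_nonneg (1 - (inner ℂ v u : ℂ))
  have q1 : |a - b| = 0 := by linarith
  have q2 : ‖1 - (inner ℂ v u : ℂ)‖ = 0 := by linarith
  rw [abs_eq_zero, sub_eq_zero] at q1
  rw [norm_eq_zero, sub_eq_zero] at q2
  have := (inner_eq_one_iff_of_norm_eq_one (𝕜 := ℂ) hv hu).1 q2.symm
  exact h (by rw [q1, this])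

lemma aux_diff {n : ℕ} (z w ζ : En n) (hz : z ∈ uball n) (hw : w ∈ uball n)
    (hζ : ζ ∈ uball n) :
    ‖herm z w - herm z ζ‖ ≤ 2 * rho w ζ + 2 * √(rho w ζ * ‖1 - herm z ζ‖) := by
  have hz1 : ‖z‖ < 1 := by simpa [uball] using hz
  have hw1 : ‖w‖ < 1 := by simpa [uball] using hw
  have hζ1 : ‖ζ‖ < 1 := by simpa [uball] using hζ
  have hr := aux_rho_nonneg w ζ
  have hs := Real.sqrt_nonneg (rho w ζ * ‖1 - herm z ζ‖)
  by_cases h0 : w = 0 ∨ ζ = 0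
  · have e := aux_rho_zero _ _ h0
    have : ‖herm z w - herm z ζ‖ ≤ ‖w‖ + ‖ζ‖ := by
      rw [aux_herm, aux_herm, ← inner_sub_left]
      refine (norm_inner_le_norm _ _).trans ?_
      have := norm_sub_le w ζ
      nlinarith [norm_nonneg (w - ζ), norm_nonneg z]
    linarith
  push Not at h0
  obtain ⟨u, hu, hwu⟩ := aux_unit w h0.1
  obtain ⟨v, hv, hζv⟩ := aux_unit ζ h0.2
  have ha : 0 < ‖w‖ := norm_pos_iff.2 h0.1
  have hb : 0 < ‖ζ‖ := norm_pos_iff.2 h0.2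
  generalize ‖w‖ = a at *
  generalize ‖ζ‖ = b at *
  subst hwu hζv
  have hk := aux_key u v z hu hv hz1.le
  have hR := aux_rho a b u v ha hb hu hv
  set R := rho ((a : ℂ) • u) ((b : ℂ) • v)
  set B := ‖1 - herm z ((b : ℂ) • v)‖ with hB
  have hgR : ‖1 - (inner ℂ v u : ℂ)‖ ≤ R := by rw [hR]; linarith [abs_nonneg (a - b)]
  have haR : |a - b| ≤ R := by rw [hR]; linarith [norm_nonneg (1 - (inner ℂ v u : ℂ))]
  have hkB : 1 - ‖(inner ℂ v z : ℂ)‖ ≤ B := by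
    have := norm_sub_norm_le (1 : ℂ) (herm z ((b : ℂ) • v))
    rw [norm_one, ← hB, aux_herm, inner_smul_left, Complex.conj_ofReal, norm_mul,
      Complex.norm_real, Real.norm_of_nonneg hb.le] at this
    nlinarith [norm_nonneg (inner ℂ v z : ℂ)]
  have hk1 : ‖(inner ℂ v z : ℂ)‖ ≤ 1 := by
    refine (norm_inner_le_norm _ _).trans ?_
    rw [hv]; linarith
  have hsq : √(‖1 - (inner ℂ v u : ℂ)‖ * (1 - ‖(inner ℂ v z : ℂ)‖)) ≤ √(R * B) := by
    apply Real.sqrt_le_sqrt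
    exact mul_le_mul hgR hkB (by linarith) hr
  have hdec : herm z ((a : ℂ) • u) - herm z ((b : ℂ) • v) =
      ((a - b : ℝ) : ℂ) * inner ℂ u z + (b : ℂ) * inner ℂ (u - v) z := by
    rw [aux_herm, aux_herm]
    simp only [inner_sub_left, inner_smul_left, Complex.conj_ofReal]
    push_cast; ring
  rw [hdec]
  have t1 : ‖((a - b : ℝ) : ℂ) * inner ℂ u z‖ ≤ |a - b| := by
    rw [norm_mul, Complex.norm_real, Real.norm_eq_abs]
    refine mul_le_of_le_one_right (abs_nonneg _) ?_
    refine (norm_inner_le_norm _ _).trans ?_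
    rw [hu]; linarith
  have t2 : ‖(b : ℂ) * inner ℂ (u - v) z‖ ≤ ‖(inner ℂ (u - v) z : ℂ)‖ := by
    rw [norm_mul, Complex.norm_real, Real.norm_of_nonneg hb.le]
    exact mul_le_of_le_one_left (norm_nonneg _) hζ1.le
  have := norm_add_le (((a - b : ℝ) : ℂ) * inner ℂ u z) ((b : ℂ) * inner ℂ (u - v) z)
  linarith

lemma aux_re {n : ℕ} (z w : En n) (hz : z ∈ uball n) (hw : w ∈ uball n) :
    0 < (1 - herm z w).re := by
  have hz1 : ‖z‖ < 1 := by simpa [uball] using hz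
  have hw1 : ‖w‖ < 1 := by simpa [uball] using hw
  have h : ‖herm z w‖ < 1 := by
    rw [aux_herm]
    refine (norm_inner_le_norm _ _).trans_lt ?_
    nlinarith [norm_nonneg z, norm_nonneg w]
  have := Complex.re_le_norm (herm z w)
  simp; linarith

lemma aux_cpow (s : ℝ) (hs : 0 < s) (A B : ℂ) (hA : 0 < A.re) (hB : 0 < B.re)
    (hAB : ‖A - B‖ ≤ ‖B‖ / 2) :
    ‖A ^ ((-s : ℝ) : ℂ) - B ^ ((-s : ℝ) : ℂ)‖ ≤ s * (‖B‖ / 2) ^ (-s - 1) * ‖A - B‖ := by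
  have hB0 : 0 < ‖B‖ := by
    rw [norm_pos_iff]; rintro rfl; simp at hB
  have hconv : Convex ℝ ({c : ℂ | 0 < c.re} ∩ Metric.closedBall B (‖B‖ / 2)) :=
    (convex_halfSpace_re_gt 0).inter (convex_closedBall _ _)
  refine hconv.norm_image_sub_le_of_norm_hasDerivWithin_le
    (f := fun x => x ^ ((-s : ℝ) : ℂ))
    (f' := fun x => ((-s : ℝ) : ℂ) * x ^ (((-s : ℝ) : ℂ) - 1)) ?_ ?_ ?_ ?_
  · intro x hx
    have := (hasDerivAt_id x).cpow_const (c := ((-s : ℝ) : ℂ)) (Or.inl hx.1)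
    simpa using this.hasDerivWithinAt
  · intro x hx
    have h1 : ‖B‖ / 2 ≤ ‖x‖ := by
      have h2 : ‖x - B‖ ≤ ‖B‖ / 2 := by simpa [dist_eq_norm] using hx.2
      have := norm_sub_norm_le B x
      rw [norm_sub_rev] at this
      linarith
    have e : (((-s : ℝ) : ℂ) - 1) = ((-s - 1 : ℝ) : ℂ) := by push_cast; ring
    rw [norm_mul, e, Complex.norm_cpow_real, Complex.norm_real, norm_neg,
      Real.norm_of_nonneg hs.le]
    gcongr ?_ * ?_
    exact Real.rpow_le_rpow_of_nonpos (by positivity) h1 (by linarith)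
  · exact ⟨hB, Metric.mem_closedBall_self (by positivity)⟩
  · exact ⟨hA, by simpa [dist_eq_norm] using hAB⟩

/-- Calderón–Zygmund estimates for the Bergman kernel with respect to
the pseudo-metric `ϱ`. -/
theorem stmt11 (n : ℕ) (hn : 1 ≤ n) (α : ℝ) (hα : -1 < α) :
    (∃ C₁ : ℝ, 0 < C₁ ∧ ∀ z ∈ uball n, ∀ w ∈ uball n, z ≠ w →
      ‖1 - herm z w‖ ^ (-((n : ℝ) + 1 + α)) ≤ C₁ / rho z w ^ ((n : ℝ) + 1 + α)) ∧
    (∃ C₂ C₃ : ℝ, 0 < C₂ ∧ 0 < C₃ ∧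
      ∀ z ∈ uball n, ∀ w ∈ uball n, ∀ ζ ∈ uball n, rho z ζ > C₂ * rho w ζ →
        ‖bergKer α z w - bergKer α z ζ‖ ≤
          C₃ * rho w ζ ^ ((1 : ℝ) / 2) / rho z ζ ^ ((n : ℝ) + 1 + α + 1 / 2)) := by
  have hn0 : (0 : ℝ) ≤ n := Nat.cast_nonneg n
  have hs : 0 < (n : ℝ) + 1 + α := by linarith
  have hker : ∀ z w : En n, bergKer α z w =
      (1 - herm z w) ^ ((-((n : ℝ) + 1 + α) : ℝ) : ℂ) := by
    intro z w; rw [bergKer]; push_cast; rfl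
  generalize (n : ℝ) + 1 + α = s at *
  refine ⟨⟨3 ^ s, by positivity, ?_⟩,
    ⟨300, 3 * s * 2 ^ (s + 1) * 3 ^ (s + 1 / 2), by norm_num, by positivity, ?_⟩⟩
  · intro z hz w hw hzw
    have h1 := aux_rho_pos z w hzw
    have h2 := aux_rho_le z w hz hw
    rw [← Real.div_rpow (by norm_num) h1.le, Real.rpow_neg (norm_nonneg _),
      ← Real.inv_rpow (norm_nonneg _)]
    have hB0 : 0 < ‖1 - herm z w‖ := by linarith
    apply Real.rpow_le_rpow (by positivity) _ hs.le
    rw [inv_eq_one_div, div_le_div_iff₀ hB0 h1]; linarith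
  · intro z hz w hw ζ hζ hR
    have hr0 := aux_rho_nonneg w ζ
    have hRB := aux_rho_le z ζ hz hζ
    have hd := aux_diff z w ζ hz hw hζ
    have hA := aux_re z w hz hw
    have hB := aux_re z ζ hz hζ
    rw [hker, hker]
    have hAB : ‖(1 - herm z w) - (1 - herm z ζ)‖ = ‖herm z w - herm z ζ‖ := by
      rw [← norm_neg]; congr 1; ring
    rw [← hAB] at hd
    generalize 1 - herm z w = A at *
    generalize 1 - herm z ζ = B at *
    generalize rho w ζ = r at *
    generalize rho z ζ = R at *
    have hR0 : 0 < R := by linarith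
    have hB0 : 0 < ‖B‖ := by linarith
    have hrB : r ≤ ‖B‖ / 100 := by linarith
    set q := √r with hq
    set b := √‖B‖ with hb
    have hq0 : 0 ≤ q := Real.sqrt_nonneg _
    have hb0 : 0 < b := Real.sqrt_pos.2 hB0
    have hq2 : q ^ 2 = r := Real.sq_sqrt hr0
    have hb2 : b ^ 2 = ‖B‖ := Real.sq_sqrt hB0.le
    have hqb : q ≤ b / 10 := by
      refine (sq_le_sq₀ hq0 (by positivity)).1 ?_
      rw [div_pow, hq2, hb2]; linarith
    rw [Real.sqrt_mul hr0, ← hq, ← hb] at hd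
    have hd3 : ‖A - B‖ ≤ 3 * (q * b) := by nlinarith
    have hhalf : ‖A - B‖ ≤ ‖B‖ / 2 := by nlinarith
    refine (aux_cpow s hs A B hA hB hhalf).trans ?_
    have e1 : r ^ ((1 : ℝ) / 2) = q := (Real.sqrt_eq_rpow r).symm
    have e2 : (‖B‖ / 2) ^ (-s - 1) = 2 ^ (s + 1) * (‖B‖ ^ (-(s + 1 / 2)) * b⁻¹) := by
      rw [hb, Real.sqrt_eq_rpow, ← Real.rpow_neg hB0.le, ← Real.rpow_add hB0,
        Real.div_rpow hB0.le (by norm_num), div_eq_mul_inv,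
        ← Real.rpow_neg (by norm_num : (0 : ℝ) ≤ 2), mul_comm]
      congr 2 <;> ring
    have e3 : ‖B‖ ^ (-(s + 1 / 2)) ≤ 3 ^ (s + 1 / 2) / R ^ (s + 1 / 2) := by
      rw [← Real.div_rpow (by norm_num) hR0.le, Real.rpow_neg hB0.le,
        ← Real.inv_rpow hB0.le]
      apply Real.rpow_le_rpow (by positivity) _ (by linarith)
      rw [inv_eq_one_div, div_le_div_iff₀ hB0 hR0]; linarith
    rw [e1, e2]
    calc s * (2 ^ (s + 1) * (‖B‖ ^ (-(s + 1 / 2)) * b⁻¹)) * ‖A - B‖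
        ≤ s * (2 ^ (s + 1) * (‖B‖ ^ (-(s + 1 / 2)) * b⁻¹)) * (3 * (q * b)) := by gcongr
      _ = 3 * s * 2 ^ (s + 1) * q * ‖B‖ ^ (-(s + 1 / 2)) := by field_simp
      _ ≤ 3 * s * 2 ^ (s + 1) * q * (3 ^ (s + 1 / 2) / R ^ (s + 1 / 2)) := by gcongr
      _ = _ := by ring
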